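/- Let Φ : ℤ^m → 𝒞 be a discrete frame with associated net F. Then for every t ∈ ℤ^m and all 1 ≤ i ≠ j ≤ m, the four isotropic vectors F(t), F(t+t_i), F(t+t_i+t_j), F(t+t_j) are linearly dependent in ℝ^{n+2}; that is, the vertices of every elementary quadrilateral (2-cell) of the net F are concircular points of the conformal n-sphere, so F (and likewise F̂) is a discrete curvature line net. -/

import Mathlib

open CliffordAlgebra

noncomputable section

/-- Target Gram matrix of a pseudo-orthonormal basis `(e₀, e₁, …, e_n, e_∞)` of
Minkowski space `ℝ^{n+2}_1` (`e₀` at index `0`, `e_∞` at the last index):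
`⟨e₀,e₀⟩ = ⟨e_∞,e_∞⟩ = 0`, `⟨e₀,e_∞⟩ = −1/2` (so that `e₀e_∞ + e_∞e₀ = 1` in the
Clifford algebra of `v ↦ −⟨v,v⟩`), `⟨e_i,e_i⟩ = 1` for `1 ≤ i ≤ n` (so `e_i² = −1`),
and all other products vanish (so distinct basis vectors anticommute). -/
def gram (n : ℕ) (i j : Fin (n + 2)) : ℝ :=
  if (i = 0 ∧ j = Fin.last (n + 1)) ∨ (i = Fin.last (n + 1) ∧ j = 0) then -(1 / 2)
  else if i = j ∧ i ≠ 0 ∧ i ≠ Fin.last (n + 1) then 1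
  else 0

/-- The quadratic form `v ↦ −⟨v,v⟩` associated to a bilinear form `B`. -/
def Qneg {V : Type*} [AddCommGroup V] [Module ℝ V]
    (B : LinearMap.BilinForm ℝ V) : QuadraticForm ℝ V :=
  -(LinearMap.BilinMap.toQuadraticMap B)

/-- The index in `Fin (n+2)` of the basis vector `e_j` for `1 ≤ j ≤ m ≤ n`
(`j : Fin m` denoting the `j`-th lattice direction). -/
def idx {n m : ℕ} (hmn : m ≤ n) (j : Fin m) : Fin (n + 2) :=
  ⟨j.val + 1, by have := j.isLt; omega⟩

variable {n m : ℕ}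

/-- `Φ : ℤ^m → 𝒞` is a discrete frame for the pseudo-orthonormal basis `e` and the
unit vectors `s_j(t)`: `Φ(0) = 1`, `s_j(t)² = −1` in `𝒞`, and
`Φ(t + t_j) = e_j · s_j(t) · Φ(t)`. -/
def IsDiscreteFrame (hmn : m ≤ n) (B : LinearMap.BilinForm ℝ (Fin (n + 2) → ℝ))
    (e : Fin (n + 2) → (Fin (n + 2) → ℝ))
    (s : Fin m → (Fin m → ℤ) → (Fin (n + 2) → ℝ))
    (Φ : (Fin m → ℤ) → CliffordAlgebra (Qneg B)) : Prop :=
  Φ 0 = 1 ∧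
  (∀ (j : Fin m) (t : Fin m → ℤ),
    ι (Qneg B) (s j t) * ι (Qneg B) (s j t) = -1) ∧
  (∀ (t : Fin m → ℤ) (j : Fin m),
    Φ (t + Pi.single j 1) = ι (Qneg B) (e (idx hmn j)) * ι (Qneg B) (s j t) * Φ t)

/-- The net `F(t) = Φ(t)⁻¹ e₀ Φ(t)`. -/
def Fnet (B : LinearMap.BilinForm ℝ (Fin (n + 2) → ℝ))
    (e : Fin (n + 2) → (Fin (n + 2) → ℝ))
    (Φ : (Fin m → ℤ) → CliffordAlgebra (Qneg B)) (t : Fin m → ℤ) :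
    CliffordAlgebra (Qneg B) :=
  Ring.inverse (Φ t) * ι (Qneg B) (e 0) * Φ t

/-- The net `F̂(t) = Φ(t)⁻¹ e_∞ Φ(t)`. -/
def Fhat (B : LinearMap.BilinForm ℝ (Fin (n + 2) → ℝ))
    (e : Fin (n + 2) → (Fin (n + 2) → ℝ))
    (Φ : (Fin m → ℤ) → CliffordAlgebra (Qneg B)) (t : Fin m → ℤ) :
    CliffordAlgebra (Qneg B) :=
  Ring.inverse (Φ t) * ι (Qneg B) (e (Fin.last (n + 1))) * Φ t

/-- The element sphere `S_j(t) = Φ(t)⁻¹ e_j Φ(t + t_j)` attached to the edge from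
`t` to `t + t_j`. -/
def Snet (hmn : m ≤ n) (B : LinearMap.BilinForm ℝ (Fin (n + 2) → ℝ))
    (e : Fin (n + 2) → (Fin (n + 2) → ℝ))
    (Φ : (Fin m → ℤ) → CliffordAlgebra (Qneg B)) (j : Fin m) (t : Fin m → ℤ) :
    CliffordAlgebra (Qneg B) :=
  Ring.inverse (Φ t) * ι (Qneg B) (e (idx hmn j)) * Φ (t + Pi.single j 1)

namespace CliffordAlgebra

section Injectivity

variable {R M : Type*} [CommRing R] [Invertible (2 : R)] [AddCommGroup M] [Module R M]
  (Q : QuadraticForm R M)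

theorem ι_injective_of_invertible_two : Function.Injective (ι Q) := fun u v h => by
  simpa using congrArg (equivExterior Q) h

theorem algebraMap_injective_of_invertible_two :
    Function.Injective (algebraMap R (CliffordAlgebra Q)) := fun u v h => by
  simpa using congrArg (equivExterior Q) h

end Injectivity

section Sandwich

variable {R M : Type*} [CommRing R] [AddCommGroup M] [Module R M] {Q : QuadraticForm R M}

theorem ι_mul_self_of_eq_neg_one {a : M} (ha : Q a = -1) : ι Q a * ι Q a = -1 := by
  rw [ι_sq_scalar, ha, map_neg, map_one]

theorem ι_mul_ι_mul_ι_of_eq_neg_one {a : M} (ha : Q a = -1) (v : M) :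
    ι Q a * ι Q v * ι Q a = ι Q (QuadraticMap.polar Q a v • a + v) := by
  rw [ι_mul_ι_mul_ι, ha]
  simp

theorem ι_mul_ι_mul_ι_of_isOrtho {a v : M} (ha : Q a = -1)
    (h : QuadraticMap.polar Q a v = 0) : ι Q a * ι Q v * ι Q a = ι Q v := by
  rw [ι_mul_ι_mul_ι_of_eq_neg_one ha, h, zero_smul, zero_add]

/-- The unit of the Clifford algebra given by a vector of square `-1`. -/
def unitOfEqNegOne (a : M) (ha : Q a = -1) : (CliffordAlgebra Q)ˣ where
  val := ι Q a
  inv := -ι Q a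
  val_inv := by rw [mul_neg, ι_mul_self_of_eq_neg_one ha, neg_neg]
  inv_val := by rw [neg_mul, ι_mul_self_of_eq_neg_one ha, neg_neg]

theorem unitOfEqNegOne_mem_lipschitzGroup (a : M) (ha : Q a = -1) :
    unitOfEqNegOne a ha ∈ lipschitzGroup Q :=
  Subgroup.subset_closure ⟨a, rfl⟩

end Sandwich

section Field

variable {K V : Type*} [Field K] [Invertible (2 : K)] [AddCommGroup V] [Module K V]
  {Q : QuadraticForm K V}

/-- If `ab = cd` for vectors `a`, `b`, `c`, `d`, then `a`, `b`, `d` are linearly dependent. -/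
theorem not_linearIndependent_of_ι_mul_ι_eq {a b c d : V}
    (h : ι Q a * ι Q b = ι Q c * ι Q d) : ¬ LinearIndependent K ![a, b, d] := by
  intro hli
  obtain ⟨g, hg⟩ := (Fintype.linearCombination K ![a, b, d]).exists_leftInverse_of_injective
    (LinearMap.ker_eq_bot.2 hli.fintypeLinearCombination_injective)
  have hval (i : Fin 3) : g (![a, b, d] i) = Pi.single i 1 := by
    have := LinearMap.congr_fun hg (Pi.single i 1)
    simpa using this
  let f : Module.Dual K V := LinearMap.proj 0 ∘ₗ g
  have hfa : f a = 1 := by simpa [f] using congrFun (hval 0) 0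
  have hfb : f b = 0 := by simpa [f] using congrFun (hval 1) 0
  have hfd : f d = 0 := by simpa [f] using congrFun (hval 2) 0
  have hc := congrArg (contractLeft f) h
  simp only [contractLeft_ι_mul, contractLeft_ι, hfa, hfb, hfd, map_zero, mul_zero, sub_zero,
    one_smul, ← map_smul] at hc
  have hbd := ι_injective_of_invertible_two Q hc
  have := Fintype.linearIndependent_iff.1 hli ![0, 1, -f c]
    (by simp [Fin.sum_univ_three, ← hbd]) 1
  simp at this

/-- The vertices of an elementary quadrilateral, seen from its base vertex `p`: `x`, `y` are the
edge directions, and `y a x b = x c y d` closes the quadrilateral. -/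
theorem exists_quadrilateral {p x y a b c d : V} (hx : Q x = -1) (hy : Q y = -1)
    (ha : Q a = -1) (hb : Q b = -1) (hd : Q d = -1)
    (hxp : QuadraticMap.polar Q x p = 0) (hyp : QuadraticMap.polar Q y p = 0)
    (hxy : QuadraticMap.polar Q x y = 0)
    (h : ι Q y * ι Q a * (ι Q x * ι Q b) = ι Q x * ι Q c * (ι Q y * ι Q d)) :
    ∃ q : Fin 4 → V, q 0 = p ∧
      ι Q (q 1) = ι Q b * ι Q x * ι Q p * (ι Q x * ι Q b) ∧
      ι Q (q 2) = ι Q b * ι Q x * (ι Q a * ι Q y) * ι Q p *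
        (ι Q y * ι Q a * (ι Q x * ι Q b)) ∧
      ι Q (q 3) = ι Q d * ι Q y * ι Q p * (ι Q y * ι Q d) ∧
      ¬ LinearIndependent K q := by
  let a' : V := QuadraticMap.polar Q x a • x + a
  let c' : V := QuadraticMap.polar Q y c • y + c
  have ha' : ι Q x * ι Q a * ι Q x = ι Q a' := ι_mul_ι_mul_ι_of_eq_neg_one hx a
  have hx2 := ι_mul_self_of_eq_neg_one hx
  have hy2 := ι_mul_self_of_eq_neg_one hy
  have hxy' : ι Q x * ι Q y = -(ι Q y * ι Q x) := by
    rw [eq_neg_iff_add_eq_zero, ι_mul_ι_add_swap, hxy, map_zero]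
  have hab : ι Q a' * ι Q b = ι Q (-c') * ι Q d := by
    have hcy : ι Q y * ι Q c * ι Q y = ι Q c' := ι_mul_ι_mul_ι_of_eq_neg_one hy c
    calc ι Q a' * ι Q b
        = -(ι Q x * ι Q y * (ι Q y * ι Q a * (ι Q x * ι Q b))) := by
          rw [← ha']
          linear_combination (norm := noncomm_ring)
            ι Q x * hy2 * (ι Q a * ι Q x * ι Q b)
      _ = -(ι Q x * ι Q y * (ι Q x * ι Q c * (ι Q y * ι Q d))) := by rw [h]
      _ = ι Q (-c') * ι Q d := by
          rw [hxy', map_neg, ← hcy]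
          linear_combination (norm := noncomm_ring)
            ι Q y * hx2 * (ι Q c * ι Q y * ι Q d)
  let α := QuadraticMap.polar Q b p
  let γ := QuadraticMap.polar Q a p
  let δ := QuadraticMap.polar Q d p
  have hxpx := ι_mul_ι_mul_ι_of_isOrtho hx hxp
  have hypy := ι_mul_ι_mul_ι_of_isOrtho hy hyp
  let q : Fin 4 → V := ![p, α • b + p,
    α • b + p + γ • (QuadraticMap.polar Q b a' • b + a'), δ • d + p]
  have hqb : ι Q b * ι Q p * ι Q b = ι Q (α • b + p) := ι_mul_ι_mul_ι_of_eq_neg_one hb p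
  have hqd : ι Q d * ι Q p * ι Q d = ι Q (δ • d + p) := ι_mul_ι_mul_ι_of_eq_neg_one hd p
  have hqa : ι Q a * ι Q p * ι Q a = γ • ι Q a + ι Q p := by
    rw [ι_mul_ι_mul_ι_of_eq_neg_one ha p, map_add, map_smul]
  have hba : ι Q b * ι Q a' * ι Q b = ι Q (QuadraticMap.polar Q b a' • b + a') :=
    ι_mul_ι_mul_ι_of_eq_neg_one hb a'
  refine ⟨q, rfl, ?_, ?_, ?_, fun hq => ?_⟩
  · calc ι Q (q 1) = ι Q b * (ι Q x * ι Q p * ι Q x) * ι Q b := by rw [hxpx, hqb]; rfl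
      _ = _ := by simp only [mul_assoc]
  · calc ι Q (q 2) = ι Q b * ι Q p * ι Q b + γ • (ι Q b * ι Q a' * ι Q b) := by
          rw [hqb, hba, ← map_smul, ← map_add]; rfl
      _ = ι Q b * (ι Q x * ι Q p * ι Q x) * ι Q b
          + γ • (ι Q b * (ι Q x * ι Q a * ι Q x) * ι Q b) := by rw [hxpx, ha']
      _ = ι Q b * ι Q x * (γ • ι Q a + ι Q p) * (ι Q x * ι Q b) := by
          simp only [mul_add, add_mul, mul_smul_comm, smul_mul_assoc, mul_assoc]
          rw [add_comm]
      _ = ι Q b * ι Q x * (ι Q a * (ι Q y * ι Q p * ι Q y) * ι Q a) * (ι Q x * ι Q b) := by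
          rw [hypy, hqa]
      _ = _ := by simp only [mul_assoc]
  · calc ι Q (q 3) = ι Q d * (ι Q y * ι Q p * ι Q y) * ι Q d := by rw [hypy, hqd]; rfl
      _ = _ := by simp only [mul_assoc]
  · have hle : Submodule.span K (Set.range q) ≤
        Submodule.span K (Set.range ![p, a', b, d]) := by
      have hmem (i : Fin 4) : ![p, a', b, d] i ∈
          Submodule.span K (Set.range ![p, a', b, d]) := Submodule.subset_span ⟨i, rfl⟩
      have hp : p ∈ _ := hmem 0
      have ha : a' ∈ _ := hmem 1
      have hb : b ∈ _ := hmem 2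
      have hd : d ∈ _ := hmem 3
      have hbp := Submodule.add_mem _ (Submodule.smul_mem _ α hb) hp
      rw [Submodule.span_le]
      rintro _ ⟨i, rfl⟩
      fin_cases i
      · exact hp
      · exact hbp
      · exact Submodule.add_mem _ hbp (Submodule.smul_mem _ _
          (Submodule.add_mem _ (Submodule.smul_mem _ _ hb) ha))
      · exact Submodule.add_mem _ (Submodule.smul_mem _ δ hd) hp
    have hli : LinearIndependent K ![p, a', b, d] := by
      rw [linearIndependent_iff_card_le_finrank_span] at hq ⊢
      have := FiniteDimensional.span_of_finite K (Set.finite_range ![p, a', b, d])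
      exact hq.trans (Submodule.finrank_mono hle)
    exact not_linearIndependent_of_ι_mul_ι_eq hab (linearIndependent_finSucc.1 hli).1

/-- Conjugation by an element of the Lipschitz group carries linearly dependent vectors to linearly
dependent vectors. -/
theorem exists_ι_eq_conj_of_mem_lipschitzGroup {k : Type*} {u : (CliffordAlgebra Q)ˣ}
    (hu : u ∈ lipschitzGroup Q) {q : k → V} (hq : ¬ LinearIndependent K q) :
    ∃ v : k → V, (∀ i, ι Q (v i) = ↑u⁻¹ * ι Q (q i) * ↑u) ∧ ¬ LinearIndependent K v := by
  have hex (i : k) : ∃ v, ι Q v = ↑u⁻¹ * ι Q (q i) * ↑u := by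
    obtain ⟨v, hv⟩ := lipschitzGroup.conjAct_smul_ι_mem_range_ι (inv_mem hu) (q i)
    refine ⟨v, hv.trans ?_⟩
    rw [ConjAct.units_smul_def, ConjAct.ofConjAct_toConjAct, inv_inv]
  choose v hv using hex
  refine ⟨v, hv, fun hli => hq ?_⟩
  let conj : CliffordAlgebra Q →ₗ[K] CliffordAlgebra Q :=
    LinearMap.mulRight K (u : CliffordAlgebra Q) ∘ₗ
      LinearMap.mulLeft K ((u⁻¹ : (CliffordAlgebra Q)ˣ) : CliffordAlgebra Q)
  have hcomp : ⇑(ι Q) ∘ v = ⇑(conj ∘ₗ ι Q) ∘ q := funext hv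
  have := hli.map' (ι Q) (LinearMap.ker_eq_bot.2 (ι_injective_of_invertible_two Q))
  rw [hcomp] at this
  exact this.of_comp

end Field

end CliffordAlgebra

/-- A predicate on `ℤ^m` that is invariant under the unit translations and holds at `0` holds
everywhere. -/
theorem forall_of_forall_add_single_iff {k : Type*} [Fintype k] [DecidableEq k]
    {P : (k → ℤ) → Prop} (h0 : P 0) (hP : ∀ t j, P (t + Pi.single j 1) ↔ P t) (t : k → ℤ) :
    P t := by
  have hz (j : k) (z : ℤ) : ∀ t, P (t + Pi.single j z) ↔ P t := by
    induction z using Int.induction_on with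
    | zero => simp
    | succ z ih =>
      intro t
      rw [Pi.single_add, ← add_assoc, hP, ih]
    | pred z ih =>
      intro t
      rw [← hP, add_assoc, ← Pi.single_add, sub_add_cancel, ih]
  have hs (S : Finset k) : P (∑ j ∈ S, Pi.single j (t j)) := by
    induction S using Finset.induction_on with
    | empty => simpa using h0
    | insert j S hj ih => rwa [Finset.sum_insert hj, add_comm, hz]
  simpa [Finset.univ_sum_single] using hs Finset.univ

theorem mul_mul_mul_rev_eq_one {A : Type*} [Monoid A] {x x' y y' : A} (hx : x * x' = 1)
    (hy : y * y' = 1) : x * y * (y' * x') = 1 := by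
  rw [mul_assoc, ← mul_assoc y, hy, one_mul, hx]

theorem Ring.inverse_mul_mul_mul_unit {A : Type*} [MonoidWithZero A] {x y : A} (hxy : x * y = 1)
    (hyx : y * x = 1) (u : Aˣ) (p : A) :
    Ring.inverse (x * u) * p * (x * u) = ↑u⁻¹ * (y * p * x) * u := by
  have : x * u = ((⟨x, y, hxy, hyx⟩ * u : Aˣ) : A) := rfl
  rw [this, Ring.inverse_unit, mul_inv_rev]
  simp only [Units.val_mul, mul_assoc]
  rfl

theorem polar_Qneg {V : Type*} [AddCommGroup V] [Module ℝ V] {B : LinearMap.BilinForm ℝ V}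
    (hsymm : ∀ u v, B u v = B v u) (u v : V) :
    QuadraticMap.polar (Qneg B) u v = -(2 * B u v) := by
  simp only [QuadraticMap.polar, Qneg, neg_apply,
    LinearMap.BilinMap.toQuadraticMap_apply, map_add, LinearMap.add_apply, hsymm v u]
  ring

theorem idx_ne_zero {n m : ℕ} (hmn : m ≤ n) (j : Fin m) : idx hmn j ≠ 0 := by
  simp [idx, Fin.ext_iff]

theorem idx_ne_last {n m : ℕ} (hmn : m ≤ n) (j : Fin m) : idx hmn j ≠ Fin.last (n + 1) := by
  have := j.isLt
  simp only [idx, ne_eq, Fin.ext_iff, Fin.val_last]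
  omega

theorem Qneg_idx {n m : ℕ} (hmn : m ≤ n) {B : LinearMap.BilinForm ℝ (Fin (n + 2) → ℝ)}
    {e : Fin (n + 2) → (Fin (n + 2) → ℝ)} (hgram : ∀ i j, B (e i) (e j) = gram n i j)
    (j : Fin m) : Qneg B (e (idx hmn j)) = -1 := by
  simp [Qneg, hgram, gram, idx_ne_zero, idx_ne_last]

theorem polar_Qneg_idx {n m : ℕ} (hmn : m ≤ n) {B : LinearMap.BilinForm ℝ (Fin (n + 2) → ℝ)}
    (hsymm : ∀ u v, B u v = B v u) {e : Fin (n + 2) → (Fin (n + 2) → ℝ)}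
    (hgram : ∀ i j, B (e i) (e j) = gram n i j) (j : Fin m) {l : Fin (n + 2)}
    (hl : l ≠ idx hmn j) : QuadraticMap.polar (Qneg B) (e (idx hmn j)) (e l) = 0 := by
  simp [polar_Qneg hsymm, hgram, gram, idx_ne_zero, idx_ne_last, hl.symm]

namespace IsDiscreteFrame

variable {n m : ℕ} {hmn : m ≤ n} {B : LinearMap.BilinForm ℝ (Fin (n + 2) → ℝ)}
  {e : Fin (n + 2) → (Fin (n + 2) → ℝ)} {s : Fin m → (Fin m → ℤ) → (Fin (n + 2) → ℝ)}
  {Φ : (Fin m → ℤ) → CliffordAlgebra (Qneg B)}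

theorem Qneg_eq (h : IsDiscreteFrame hmn B e s Φ) (j : Fin m) (t : Fin m → ℤ) :
    Qneg B (s j t) = -1 := by
  apply algebraMap_injective_of_invertible_two (Qneg B)
  rw [← ι_sq_scalar, h.2.1, map_neg, map_one]

theorem exists_mem_lipschitzGroup (h : IsDiscreteFrame hmn B e s Φ)
    (hgram : ∀ i j, B (e i) (e j) = gram n i j) (t : Fin m → ℤ) :
    ∃ u ∈ lipschitzGroup (Qneg B), (u : CliffordAlgebra (Qneg B)) = Φ t := by
  refine forall_of_forall_add_single_iff
    (P := fun t => ∃ u ∈ lipschitzGroup (Qneg B), (u : CliffordAlgebra (Qneg B)) = Φ t)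
    ⟨1, one_mem _, h.1.symm⟩ (fun t j => ?_) t
  let g := unitOfEqNegOne _ (Qneg_idx hmn hgram j) * unitOfEqNegOne _ (h.Qneg_eq j t)
  have hg : g ∈ lipschitzGroup (Qneg B) := mul_mem (unitOfEqNegOne_mem_lipschitzGroup _ _)
    (unitOfEqNegOne_mem_lipschitzGroup _ _)
  have hstep : Φ (t + Pi.single j 1) = g * Φ t := h.2.2 t j
  constructor
  · rintro ⟨u, hu, hut⟩
    exact ⟨g⁻¹ * u, mul_mem (inv_mem hg) hu, by
      rw [Units.val_mul, hut, hstep, Units.inv_mul_cancel_left]⟩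
  · rintro ⟨u, hu, hut⟩
    exact ⟨g * u, mul_mem hg hu, by rw [Units.val_mul, hut, hstep]⟩

/-- The vertices of every elementary quadrilateral of the net `Φ⁻¹ p Φ` are linearly dependent
vectors, for every `p` in the basis `e` other than the edge directions. -/
theorem exists_not_linearIndependent (h : IsDiscreteFrame hmn B e s Φ)
    (hsymm : ∀ u v, B u v = B v u) (hgram : ∀ i j, B (e i) (e j) = gram n i j)
    {l : Fin (n + 2)} (hl : ∀ j : Fin m, l ≠ idx hmn j) (t : Fin m → ℤ) {i j : Fin m}
    (hij : i ≠ j) :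
    let net := fun t => Ring.inverse (Φ t) * ι (Qneg B) (e l) * Φ t
    ∃ v : Fin 4 → (Fin (n + 2) → ℝ),
      ι (Qneg B) (v 0) = net t ∧
      ι (Qneg B) (v 1) = net (t + Pi.single i 1) ∧
      ι (Qneg B) (v 2) = net (t + Pi.single i 1 + Pi.single j 1) ∧
      ι (Qneg B) (v 3) = net (t + Pi.single j 1) ∧
      ¬ LinearIndependent ℝ v := by
  intro net
  obtain ⟨u, hu, hut⟩ := h.exists_mem_lipschitzGroup hgram t
  have hcancel {x y : Fin (n + 2) → ℝ} (hx : Qneg B x = -1) (hy : Qneg B y = -1) :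
      ι (Qneg B) x * ι (Qneg B) y * (ι (Qneg B) y * ι (Qneg B) x) = 1 := by
    rw [mul_assoc, ← mul_assoc (ι (Qneg B) y), ι_mul_self_of_eq_neg_one hy, neg_one_mul, mul_neg,
      ι_mul_self_of_eq_neg_one hx, neg_neg]
  have hne : idx hmn j ≠ idx hmn i := fun hidx => hij (by
    simpa [idx, Fin.ext_iff, eq_comm] using hidx)
  have he := Qneg_idx hmn hgram
  have hs := h.Qneg_eq
  have hi : Φ (t + Pi.single i 1) = _ * ↑u := hut ▸ h.2.2 t i
  have hj : Φ (t + Pi.single j 1) = _ * ↑u := hut ▸ h.2.2 t j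
  have hijt := h.2.2 (t + Pi.single i 1) j
  have hjit := h.2.2 (t + Pi.single j 1) i
  rw [hi, ← mul_assoc] at hijt
  rw [hj, ← mul_assoc, add_right_comm, hijt, Units.mul_left_inj] at hjit
  obtain ⟨q, hq0, hq1, hq2, hq3, hq⟩ := exists_quadrilateral (p := e l) (he i) (he j)
    (hs j (t + Pi.single i 1)) (hs i t) (hs j t) (polar_Qneg_idx hmn hsymm hgram i (hl i))
    (polar_Qneg_idx hmn hsymm hgram j (hl j)) (polar_Qneg_idx hmn hsymm hgram i hne) hjit
  obtain ⟨v, hv, hvli⟩ := exists_ι_eq_conj_of_mem_lipschitzGroup hu hq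
  have hci := hcancel (he i) (hs i t)
  have hci' := hcancel (hs i t) (he i)
  have hcj := hcancel (he j) (hs j (t + Pi.single i 1))
  have hcj' := hcancel (hs j (t + Pi.single i 1)) (he j)
  refine ⟨v, ?_, ?_, ?_, ?_, hvli⟩
  · simp only [net]
    rw [hv, hq0, ← hut, Ring.inverse_unit]
  · simp only [net]
    rw [hv, hq1, hi, Ring.inverse_mul_mul_mul_unit hci hci']
  · simp only [net]
    rw [hv, hq2, hijt, Ring.inverse_mul_mul_mul_unit
      (mul_mul_mul_rev_eq_one hcj hci) (mul_mul_mul_rev_eq_one hci' hcj')]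
  · simp only [net]
    rw [hv, hq3, hj, Ring.inverse_mul_mul_mul_unit (hcancel (he j) (hs j t))
      (hcancel (hs j t) (he j))]

end IsDiscreteFrame

/-- For a discrete frame `Φ` with associated net `F`, the four
isotropic vectors `F(t), F(t+t_i), F(t+t_i+t_j), F(t+t_j)` are linearly dependent
vectors of `ℝ^{n+2}` for all `i ≠ j`: the vertices of every elementary quadrilateral
(2-cell) of `F` (and likewise of `F̂`) are concircular points of the conformal
`n`-sphere, so `F` is a discrete curvature line net. -/
theorem stmt13 {n m : ℕ} (hm : 1 ≤ m) (hmn : m ≤ n)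
    (B : LinearMap.BilinForm ℝ (Fin (n + 2) → ℝ)) (hsymm : ∀ u v, B u v = B v u)
    (e : Fin (n + 2) → (Fin (n + 2) → ℝ)) (he : LinearIndependent ℝ e)
    (hgram : ∀ i j, B (e i) (e j) = gram n i j)
    (s : Fin m → (Fin m → ℤ) → (Fin (n + 2) → ℝ))
    (Φ : (Fin m → ℤ) → CliffordAlgebra (Qneg B))
    (hframe : IsDiscreteFrame hmn B e s Φ) :
    ∀ (t : Fin m → ℤ) (i j : Fin m), i ≠ j →
      (∃ v : Fin 4 → (Fin (n + 2) → ℝ),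
        ι (Qneg B) (v 0) = Fnet B e Φ t ∧
        ι (Qneg B) (v 1) = Fnet B e Φ (t + Pi.single i 1) ∧
        ι (Qneg B) (v 2) = Fnet B e Φ (t + Pi.single i 1 + Pi.single j 1) ∧
        ι (Qneg B) (v 3) = Fnet B e Φ (t + Pi.single j 1) ∧
        ¬ LinearIndependent ℝ v) ∧
      (∃ w : Fin 4 → (Fin (n + 2) → ℝ),
        ι (Qneg B) (w 0) = Fhat B e Φ t ∧
        ι (Qneg B) (w 1) = Fhat B e Φ (t + Pi.single i 1) ∧
        ι (Qneg B) (w 2) = Fhat B e Φ (t + Pi.single i 1 + Pi.single j 1) ∧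
        ι (Qneg B) (w 3) = Fhat B e Φ (t + Pi.single j 1) ∧
        ¬ LinearIndependent ℝ w) := by
  intro t i j hij
  exact ⟨hframe.exists_not_linearIndependent hsymm hgram
      (fun k => (idx_ne_zero hmn k).symm) t hij,
    hframe.exists_not_linearIndependent hsymm hgram
      (fun k => (idx_ne_last hmn k).symm) t hij⟩
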